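/- Let d ≥ 3, let V be in the reverse Hölder class RH_q for some q > d/2, let ρ be the associated critical radius function, let 1 < p < ∞, θ > 0, α ∈ [0,1), and let w ∈ A_p^{ρ,θ}(ℝ^d). There exists C > 0 such that for every f ∈ BMO^α_{L,w}(ℝ^d), every x₀ ∈ ℝ^d, every r₀ with 0 < r₀ < ρ(x₀), and every n ∈ ℕ, one has ∫_{B(x₀,2^n r₀)} |f(y) − f_{B(x₀,2^n r₀)}| dy ≤ C 2^{n(d(p+α)+pθ)} |B(x₀,r₀)|^{α} w(B(x₀,r₀)) ‖f‖_{BMO^α_{L,w}}. -/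

import Mathlib

open MeasureTheory Metric

noncomputable section

/-- Euclidean space `ℝ^d`. -/
abbrev Rd (d : ℕ) := EuclideanSpace ℝ (Fin d)

/-- The Lebesgue measure `|B(x,r)|` of a ball, as a real number. -/
noncomputable def ballVol (d : ℕ) (x : Rd d) (r : ℝ) : ℝ :=
  (volume (ball x r)).toReal

/-- The integral `∫_{B(x,r)} g`. -/
noncomputable def ballInt (d : ℕ) (x : Rd d) (r : ℝ) (g : Rd d → ℝ) : ℝ :=
  ∫ y in ball x r, g y

/-- The average `|B(x,r)|⁻¹ ∫_{B(x,r)} g`. -/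
noncomputable def ballAvg (d : ℕ) (x : Rd d) (r : ℝ) (g : Rd d → ℝ) : ℝ :=
  (ballVol d x r)⁻¹ * ballInt d x r g

/-- `V` is a nonnegative, locally integrable, not a.e. zero function in the
reverse Hölder class `RH_q(ℝ^d)`. -/
def IsRH (d : ℕ) (q : ℝ) (V : Rd d → ℝ) : Prop :=
  (∀ x, 0 ≤ V x) ∧ LocallyIntegrable V volume ∧
  ¬ (∀ᵐ x ∂(volume : Measure (Rd d)), V x = 0) ∧
  ∃ C > 0, ∀ x r, 0 < r →
    (ballAvg d x r (fun y => V y ^ q)) ^ (1/q) ≤ C * ballAvg d x r V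

/-- The critical radius function `ρ(x) = sup{r > 0 : r^{2-d} ∫_{B(x,r)} V ≤ 1}`. -/
noncomputable def criticalRadius (d : ℕ) (V : Rd d → ℝ) (x : Rd d) : ℝ :=
  sSup {r : ℝ | 0 < r ∧ r ^ (2 - (d : ℝ)) * ballInt d x r V ≤ 1}

/-- The weight `w` belongs to the class `A_p^{ρ,θ}(ℝ^d)`. -/
def MemAp (d : ℕ) (p θ : ℝ) (ρ : Rd d → ℝ) (w : Rd d → ℝ) : Prop :=
  (∀ x, 0 < w x) ∧ Measurable w ∧ LocallyIntegrable w volume ∧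
  LocallyIntegrable (fun x => w x ^ (-(1/(p-1)))) volume ∧
  ∃ C > 0, ∀ x r, 0 < r →
    (((1 + r / ρ x) ^ θ * ballVol d x r)⁻¹ * ballInt d x r w) *
      (((1 + r / ρ x) ^ θ * ballVol d x r)⁻¹ *
        ballInt d x r (fun y => w y ^ (-(1/(p-1))))) ^ (p-1) ≤ C

/-- `C` is an admissible constant in the definition of `BMO^α_{L,w}` for `f`. -/
def BMOBound (d : ℕ) (α : ℝ) (ρ w f : Rd d → ℝ) (C : ℝ) : Prop :=
  (∀ x₀ r₀, 0 < r₀ → r₀ < ρ x₀ →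
    ballInt d x₀ r₀ (fun y => |f y - ballAvg d x₀ r₀ f|) ≤
      C * (ballVol d x₀ r₀ ^ α * ballInt d x₀ r₀ w)) ∧
  (∀ x₀ r₀, ρ x₀ ≤ r₀ →
    ballInt d x₀ r₀ (fun y => |f y|) ≤
      C * (ballVol d x₀ r₀ ^ α * ballInt d x₀ r₀ w))

/-- `f` belongs to the space `BMO^α_{L,w}(ℝ^d)`. -/
def MemBMO (d : ℕ) (α : ℝ) (ρ w f : Rd d → ℝ) : Prop :=
  LocallyIntegrable f volume ∧ ∃ C > 0, BMOBound d α ρ w f C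

/-- The norm `‖f‖_{BMO^α_{L,w}}`: the least admissible constant. -/
noncomputable def bmoNorm (d : ℕ) (α : ℝ) (ρ w f : Rd d → ℝ) : ℝ :=
  sInf {C : ℝ | 0 < C ∧ BMOBound d α ρ w f C}

theorem MeasureTheory.LocallyIntegrable.integrableOn_ball {d : ℕ} {g : Rd d → ℝ}
    (hg : LocallyIntegrable g volume) (x : Rd d) (r : ℝ) : IntegrableOn g (ball x r) volume :=
  (hg.integrableOn_isCompact (isCompact_closedBall x r)).mono_set ball_subset_closedBall

theorem ballVol_pos {d : ℕ} (x : Rd d) {r : ℝ} (hr : 0 < r) : 0 < ballVol d x r :=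
  ENNReal.toReal_pos (measure_ball_pos volume x hr).ne' measure_ball_lt_top.ne

/-- Scaling of the volume of a ball. -/
theorem ballVol_mul {d : ℕ} (x : Rd d) {c r : ℝ} (hc : 0 < c) (hr : 0 < r) :
    ballVol d x (c * r) = c ^ d * ballVol d x r := by
  unfold ballVol
  rw [Measure.addHaar_ball_of_pos volume x (mul_pos hc hr), Measure.addHaar_ball_of_pos volume x hr,
    ENNReal.toReal_mul, ENNReal.toReal_mul, ENNReal.toReal_ofReal (by positivity),
    ENNReal.toReal_ofReal (by positivity), finrank_euclideanSpace_fin, mul_pow, mul_assoc]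

theorem ballInt_pos {d : ℕ} {w : Rd d → ℝ} (hpos : ∀ x, 0 < w x)
    (hw : LocallyIntegrable w volume) (x : Rd d) {r : ℝ} (hr : 0 < r) : 0 < ballInt d x r w := by
  unfold ballInt
  rw [setIntegral_pos_iff_support_of_nonneg_ae (.of_forall fun y => (hpos y).le)
    (hw.integrableOn_ball x r), (Set.eq_univ_of_forall fun y => (hpos y).ne' :
      Function.support w = Set.univ), Set.univ_inter]
  exact measure_ball_pos volume x hr

theorem ballInt_mono_radius {d : ℕ} {w : Rd d → ℝ} (hpos : ∀ x, 0 ≤ w x)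
    (hw : LocallyIntegrable w volume) (x : Rd d) {r s : ℝ} (hrs : r ≤ s) :
    ballInt d x r w ≤ ballInt d x s w :=
  setIntegral_mono_set (hw.integrableOn_ball x s) (.of_forall hpos)
    (ball_subset_ball hrs).eventuallyLE

/-- The mean oscillation integral is at most twice the integral of `|f|`. -/
theorem ballInt_abs_sub_ballAvg_le {d : ℕ} {f : Rd d → ℝ} (hf : LocallyIntegrable f volume)
    (x : Rd d) {r : ℝ} (hr : 0 < r) :
    ballInt d x r (fun y => |f y - ballAvg d x r f|) ≤ 2 * ballInt d x r (fun y => |f y|) := by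
  have hv := ballVol_pos x hr
  have hfi := hf.integrableOn_ball x r
  have hc : IntegrableOn (fun _ : Rd d => |ballAvg d x r f|) (ball x r) volume :=
    integrableOn_const measure_ball_lt_top.ne
  have havg : ballVol d x r * |ballAvg d x r f| ≤ ballInt d x r (fun y => |f y|) := by
    unfold ballAvg
    rw [abs_mul, abs_inv, abs_of_pos hv, mul_inv_cancel_left₀ hv.ne']
    exact abs_integral_le_integral_abs
  calc ballInt d x r (fun y => |f y - ballAvg d x r f|)
      ≤ ∫ y in ball x r, (|f y| + |ballAvg d x r f|) :=
        integral_mono_of_nonneg (.of_forall fun y => abs_nonneg _) (hfi.abs.add hc)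
          (.of_forall fun y => abs_sub _ _)
    _ = ballInt d x r (fun y => |f y|) + ballVol d x r * |ballAvg d x r f| := by
        rw [integral_add hfi.abs hc, setIntegral_const]
        rfl
    _ ≤ 2 * ballInt d x r (fun y => |f y|) := by linarith

/-- Hölder's inequality for a weight and its dual weight:
`|B|^p ≤ w(B) (∫_B w^{-1/(p-1)})^{p-1}`. -/
theorem ballVol_rpow_le {d : ℕ} {p : ℝ} (hp : 1 < p) {w : Rd d → ℝ} (hpos : ∀ x, 0 < w x)
    (hmeas : Measurable w) (hw : LocallyIntegrable w volume)
    (hσ : LocallyIntegrable (fun x => w x ^ (-(1/(p-1)))) volume) (x : Rd d) {r : ℝ}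
    (hr : 0 < r) :
    ballVol d x r ^ p ≤
      ballInt d x r w * ballInt d x r (fun y => w y ^ (-(1/(p-1)))) ^ (p-1) := by
  have hp0 : 0 < p := by linarith
  have hp1 : 0 < p - 1 := by linarith
  set q := p / (p - 1) with hq
  have hpq : p.HolderConjugate q := Real.HolderConjugate.conjExponent hp
  have hq0 : 0 < q := hpq.symm.pos
  have e1 : ∀ y, (w y ^ (1/p)) ^ p = w y := fun y => by
    rw [← Real.rpow_mul (hpos y).le, one_div_mul_cancel hp0.ne', Real.rpow_one]
  have e2 : ∀ y, (w y ^ (-(1/p))) ^ q = w y ^ (-(1/(p-1))) := fun y => by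
    rw [← Real.rpow_mul (hpos y).le]
    congr 1
    rw [hq]; field_simp
  have m1 : MemLp (fun y => w y ^ (1/p)) (ENNReal.ofReal p) (volume.restrict (ball x r)) := by
    rw [← integrable_norm_rpow_iff (hmeas.pow_const _).aestronglyMeasurable
      (by simpa using hp0) ENNReal.ofReal_ne_top, ENNReal.toReal_ofReal hp0.le]
    refine (hw.integrableOn_ball x r).congr (.of_forall fun y => ?_)
    simp only [Real.norm_of_nonneg (Real.rpow_nonneg (hpos y).le _), e1]
  have m2 : MemLp (fun y => w y ^ (-(1/p))) (ENNReal.ofReal q) (volume.restrict (ball x r)) := by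
    rw [← integrable_norm_rpow_iff (hmeas.pow_const _).aestronglyMeasurable
      (by simpa using hq0) ENNReal.ofReal_ne_top, ENNReal.toReal_ofReal hq0.le]
    refine (hσ.integrableOn_ball x r).congr (.of_forall fun y => ?_)
    simp only [Real.norm_of_nonneg (Real.rpow_nonneg (hpos y).le _), e2]
  have key := integral_mul_le_Lp_mul_Lq_of_nonneg hpq
    (.of_forall fun y => Real.rpow_nonneg (hpos y).le _)
    (.of_forall fun y => Real.rpow_nonneg (hpos y).le _) m1 m2
  have e3 : ∀ y, w y ^ (1/p) * w y ^ (-(1/p)) = 1 := fun y => by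
    rw [← Real.rpow_add (hpos y), add_neg_cancel, Real.rpow_zero]
  simp only [e1, e2, e3] at key
  rw [setIntegral_const, smul_eq_mul, mul_one] at key
  change ballVol d x r ≤ ballInt d x r w ^ (1/p) *
    ballInt d x r (fun y => w y ^ (-(1/(p-1)))) ^ (1/q) at key
  have hw0 := (ballInt_pos hpos hw x hr).le
  have hσ0 := (ballInt_pos (fun y => Real.rpow_pos_of_pos (hpos y) (-(1/(p-1)))) hσ x hr).le
  calc ballVol d x r ^ p ≤ _ := Real.rpow_le_rpow (ballVol_pos x hr).le key hp0.le
    _ = _ := by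
        rw [Real.mul_rpow (Real.rpow_nonneg hw0 _) (Real.rpow_nonneg hσ0 _),
          ← Real.rpow_mul hw0, ← Real.rpow_mul hσ0, one_div_mul_cancel hp0.ne', Real.rpow_one]
        congr 2
        rw [hq]; field_simp

/-- Comparison of a weight in `A_p^{ρ,θ}` on concentric balls. -/
theorem MemAp.exists_ballInt_mul_le {d : ℕ} {p θ : ℝ} (hp : 1 < p) {ρ w : Rd d → ℝ}
    (hρ : ∀ x, 0 < ρ x) (hw : MemAp d p θ ρ w) :
    ∃ C > 0, ∀ x r s, 0 < r → r ≤ s →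
      ballInt d x s w * ballVol d x r ^ p ≤
        C * ((1 + s / ρ x) ^ θ * ballVol d x s) ^ p * ballInt d x r w := by
  obtain ⟨hpos, hmeas, hwi, hσi, C, hC, hA⟩ := hw
  refine ⟨C, hC, fun x r s hr hrs => ?_⟩
  have hs : 0 < s := hr.trans_le hrs
  have hp1 : 0 < p - 1 := by linarith
  have hσpos : ∀ y, 0 < w y ^ (-(1/(p-1))) := fun y => Real.rpow_pos_of_pos (hpos y) _
  have hH := ballVol_rpow_le hp hpos hmeas hwi hσi x hr
  have hmono := ballInt_mono_radius (fun y => (hσpos y).le) hσi x hrs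
  have hA := hA x s hs
  have hW := ballInt_pos hpos hwi x hr
  have hWs := ballInt_pos hpos hwi x hs
  have hS := ballInt_pos hσpos hσi x hr
  have hSs := ballInt_pos hσpos hσi x hs
  set T := (1 + s / ρ x) ^ θ * ballVol d x s
  have hT : 0 < T := mul_pos (Real.rpow_pos_of_pos
    (by have := div_pos hs (hρ x); linarith) _) (ballVol_pos x hs)
  set S := ballInt d x r (fun y => w y ^ (-(1/(p-1))))
  set S' := ballInt d x s (fun y => w y ^ (-(1/(p-1))))
  have hA' : ballInt d x s w * S' ^ (p-1) ≤ C * T ^ p := by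
    rw [Real.mul_rpow (inv_nonneg.2 hT.le) hSs.le, Real.inv_rpow hT.le] at hA
    have hTp : T ^ p = T * T ^ (p-1) := by
      rw [← Real.rpow_one_add' hT.le (by linarith), add_sub_cancel]
    have h1 : 0 < T ^ (p-1) := Real.rpow_pos_of_pos hT _
    rw [hTp]
    calc ballInt d x s w * S' ^ (p-1)
        = (T⁻¹ * ballInt d x s w * ((T ^ (p-1))⁻¹ * S' ^ (p-1))) * (T * T ^ (p-1)) := by
          field_simp
      _ ≤ C * (T * T ^ (p-1)) := by gcongr
  calc ballInt d x s w * ballVol d x r ^ p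
      ≤ ballInt d x s w * (ballInt d x r w * S ^ (p-1)) := by gcongr
    _ ≤ ballInt d x s w * (ballInt d x r w * S' ^ (p-1)) := by gcongr
    _ = (ballInt d x s w * S' ^ (p-1)) * ballInt d x r w := by ring
    _ ≤ C * T ^ p * ballInt d x r w := by gcongr

/-- Growth of an `A_p^{ρ,θ}` weight under dyadic dilations of subcritical balls. -/
theorem MemAp.exists_ballInt_two_pow_le {d : ℕ} {p θ : ℝ} (hp : 1 < p) (hθ : 0 < θ)
    {ρ w : Rd d → ℝ} (hρ : ∀ x, 0 < ρ x) (hw : MemAp d p θ ρ w) :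
    ∃ C > 0, ∀ x r, 0 < r → r < ρ x → ∀ n : ℕ,
      ballInt d x (2 ^ n * r) w ≤
        C * 2 ^ ((n : ℝ) * (d * p + p * θ)) * ballInt d x r w := by
  obtain ⟨C, hC, h⟩ := hw.exists_ballInt_mul_le hp hρ
  refine ⟨C * 2 ^ (θ * p), by positivity, fun x r hr hrρ n => ?_⟩
  have h2 : (1 : ℝ) ≤ 2 ^ n := one_le_pow₀ (by norm_num)
  have hv := ballVol_pos x hr
  have hW := ballInt_pos hw.1 hw.2.2.1 x hr
  have key := h x r (2 ^ n * r) hr (le_mul_of_one_le_left hr.le h2)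
  have hq0 : 0 ≤ 2 ^ n * r / ρ x := div_nonneg (by positivity) (hρ x).le
  have hΨ : (1 + 2 ^ n * r / ρ x) ^ θ ≤ (2 * 2 ^ n : ℝ) ^ θ := by
    have : 2 ^ n * r / ρ x ≤ 2 ^ n := by
      rw [div_le_iff₀ (hρ x)]
      gcongr
    exact Real.rpow_le_rpow (by linarith) (by linarith) hθ.le
  have hT : ((1 + 2 ^ n * r / ρ x) ^ θ * ballVol d x (2 ^ n * r)) ^ p ≤
      2 ^ (θ * p) * 2 ^ ((n : ℝ) * (d * p + p * θ)) * ballVol d x r ^ p := by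
    rw [ballVol_mul x (by positivity) hr]
    calc _ ≤ ((2 * 2 ^ n : ℝ) ^ θ * (((2 : ℝ) ^ n) ^ d * ballVol d x r)) ^ p := by
          refine Real.rpow_le_rpow ?_ ?_ (by linarith)
          · have : 0 ≤ (1 + 2 ^ n * r / ρ x) ^ θ := Real.rpow_nonneg (by linarith) _
            positivity
          · gcongr
      _ = _ := by
          rw [Real.mul_rpow (by positivity) (by positivity),
            Real.mul_rpow (by positivity) hv.le, ← mul_assoc]
          congr 1
          rw [← Real.rpow_natCast 2 n, ← Real.rpow_natCast _ d, ← Real.rpow_one_add' (by norm_num)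
            (by positivity), ← Real.rpow_mul (by positivity), ← Real.rpow_mul (by positivity),
            ← Real.rpow_mul (by positivity), ← Real.rpow_mul (by positivity),
            ← Real.rpow_add (by norm_num), ← Real.rpow_add (by norm_num)]
          congr 1
          ring
  have hvp : 0 < ballVol d x r ^ p := Real.rpow_pos_of_pos hv p
  refine le_of_mul_le_mul_right ?_ hvp
  calc _ ≤ _ := key
    _ ≤ C * (2 ^ (θ * p) * 2 ^ ((n : ℝ) * (d * p + p * θ)) * ballVol d x r ^ p) *
        ballInt d x r w := by gcongr
    _ = _ := by ring

/-- Uniform oscillation bound on all balls in terms of the `BMO^α_{L,w}` norm. -/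
theorem MemBMO.ballInt_abs_sub_ballAvg_le {d : ℕ} {α : ℝ} {ρ w f : Rd d → ℝ}
    (hpos : ∀ x, 0 < w x) (hw : LocallyIntegrable w volume) (hf : MemBMO d α ρ w f)
    (x : Rd d) {r : ℝ} (hr : 0 < r) :
    ballInt d x r (fun y => |f y - ballAvg d x r f|) ≤
      2 * (ballVol d x r ^ α * ballInt d x r w) * bmoNorm d α ρ w f := by
  obtain ⟨hfi, C₀, hC₀, hB₀⟩ := hf
  have hX : 0 < ballVol d x r ^ α * ballInt d x r w :=
    mul_pos (Real.rpow_pos_of_pos (ballVol_pos x hr) _) (ballInt_pos hpos hw x hr)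
  rw [← div_le_iff₀' (by positivity)]
  refine le_csInf ⟨C₀, hC₀, hB₀⟩ fun C ⟨hC, hB⟩ => ?_
  rw [div_le_iff₀' (by positivity)]
  have hCX := mul_pos hC hX
  rcases lt_or_ge r (ρ x) with h | h
  · linarith [hB.1 x r hr h]
  · linarith [hB.2 x r h, _root_.ballInt_abs_sub_ballAvg_le hfi x hr]

/-- Estimate for the oscillation integral of `f ∈ BMO^α_{L,w}` over dilated balls:
`∫_{B(x₀,2^n r₀)} |f - f_{B(x₀,2^n r₀)}| ≤ C 2^{n(d(p+α)+pθ)} |B(x₀,r₀)|^α w(B(x₀,r₀)) ‖f‖`. -/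
theorem statement19 (d : ℕ) (hd : 3 ≤ d) (q : ℝ) (hq : (d : ℝ) / 2 < q)
    (V : Rd d → ℝ) (hV : IsRH d q V)
    (ρ : Rd d → ℝ) (hρ : ρ = criticalRadius d V) (hρpos : ∀ x, 0 < ρ x)
    (p θ α : ℝ) (hp : 1 < p) (hθ : 0 < θ) (hα : 0 ≤ α) (hα1 : α < 1)
    (w : Rd d → ℝ) (hw : MemAp d p θ ρ w) :
    ∃ C > 0, ∀ f : Rd d → ℝ, MemBMO d α ρ w f →
      ∀ (x₀ : Rd d) (r₀ : ℝ), 0 < r₀ → r₀ < ρ x₀ → ∀ n : ℕ,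
        ballInt d x₀ (2 ^ n * r₀) (fun y => |f y - ballAvg d x₀ (2 ^ n * r₀) f|) ≤
          C * 2 ^ ((n : ℝ) * ((d : ℝ) * (p + α) + p * θ)) *
            ballVol d x₀ r₀ ^ α * ballInt d x₀ r₀ w * bmoNorm d α ρ w f := by
  obtain ⟨C, hC, h⟩ := hw.exists_ballInt_two_pow_le hp hθ hρpos
  refine ⟨2 * C, by positivity, fun f hf x₀ r₀ hr₀ hr₀ρ n => ?_⟩
  have hv := ballVol_pos x₀ hr₀
  have hN : 0 ≤ bmoNorm d α ρ w f := Real.sInf_nonneg fun C hC => hC.1.le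
  have hvol : ballVol d x₀ (2 ^ n * r₀) ^ α =
      2 ^ ((n : ℝ) * (d * α)) * ballVol d x₀ r₀ ^ α := by
    rw [ballVol_mul x₀ (by positivity) hr₀, Real.mul_rpow (by positivity) hv.le,
      ← Real.rpow_natCast 2 n, ← Real.rpow_natCast _ d, ← Real.rpow_mul (by positivity),
      ← Real.rpow_mul (by positivity)]
  have hexp : (2 : ℝ) ^ ((n : ℝ) * ((d : ℝ) * (p + α) + p * θ)) =
      2 ^ ((n : ℝ) * (d * α)) * 2 ^ ((n : ℝ) * (d * p + p * θ)) := by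
    rw [← Real.rpow_add (by norm_num)]
    congr 1
    ring
  calc _ ≤ 2 * (ballVol d x₀ (2 ^ n * r₀) ^ α * ballInt d x₀ (2 ^ n * r₀) w) *
        bmoNorm d α ρ w f :=
        hf.ballInt_abs_sub_ballAvg_le hw.1 hw.2.2.1 x₀ (by positivity)
    _ ≤ 2 * (2 ^ ((n : ℝ) * (d * α)) * ballVol d x₀ r₀ ^ α *
        (C * 2 ^ ((n : ℝ) * (d * p + p * θ)) * ballInt d x₀ r₀ w)) * bmoNorm d α ρ w f := by
        rw [hvol]
        gcongr
        exact h x₀ r₀ hr₀ hr₀ρ n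
    _ = _ := by
        rw [hexp]
        ring
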